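/- The symmetric group S_6 has exactly two table automorphisms; that is, the set of pairs (σ, τ) that are table automorphisms of S_6 has exactly two elements. -/

import Mathlib

/-- `f : G → ℂ` is an irreducible character of `G` if it is the character of some
irreducible (simple) finite-dimensional complex representation of `G`. -/
def IsIrrChar (G : Type) [Group G] (f : G → ℂ) : Prop :=
  ∃ V : FDRep ℂ G, CategoryTheory.Simple V ∧ f = V.character

/-- `(σ, τ)` is a table automorphism of `G`: `σ` permutes the irreducible characters,
`τ` permutes the conjugacy classes, and for every irreducible character `f`, every `g`,
and every `h` whose conjugacy class is `τ` of the class of `g`, `(σ f) h = f g`. -/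
def IsTableAut (G : Type) [Group G]
    (σ : Equiv.Perm {f : G → ℂ // IsIrrChar G f})
    (τ : Equiv.Perm (ConjClasses G)) : Prop :=
  ∀ (f : {f : G → ℂ // IsIrrChar G f}) (g h : G),
    ConjClasses.mk h = τ (ConjClasses.mk g) → (σ f).1 h = f.1 g

/-- Characters of irreducible representations are irreducible characters. -/
theorem isIrrChar_character {G V : Type} [Group G] [Finite G] [AddCommGroup V] [Module ℂ V]
    [FiniteDimensional ℂ V] (ρ : Representation ℂ G V) [ρ.IsIrreducible] :
    IsIrrChar G ρ.character := by
  classical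
  cases nonempty_fintype G
  refine ⟨FDRep.of ρ, ?_, rfl⟩
  have := invertibleOfNonzero (NeZero.ne (Nat.card G : ℂ))
  have h := Representation.char_orthonormal ρ ρ
  rw [if_pos ⟨.refl ρ⟩] at h
  rw [FDRep.simple_iff_char_is_norm_one]
  exact (inv_mul_eq_one₀ (NeZero.ne (Nat.card G : ℂ))).mp h |>.symm

open scoped MonoidAlgebra in
/-- A class function orthogonal to all irreducible characters vanishes. -/
theorem eq_zero_of_orthogonal_irrChar {G : Type} [Group G] [Fintype G] (φ : G → ℂ)
    (hφ : ∀ g h, φ (h * g * h⁻¹) = φ g)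
    (horth : ∀ f, IsIrrChar G f → ∑ g, φ g * f g = 0) : φ = 0 := by
  classical
  let a : ℂ[G] := ∑ g, MonoidAlgebra.single g (φ g)
  have hsingle : ∀ h : G, a * MonoidAlgebra.single h 1 = MonoidAlgebra.single h 1 * a := by
    intro h
    simp only [a, Finset.sum_mul, Finset.mul_sum, MonoidAlgebra.single_mul_single, mul_one,
      one_mul]
    refine Fintype.sum_equiv (MulAut.conj h⁻¹).toEquiv _ _ fun g => ?_
    have := hφ g h⁻¹
    rw [inv_inv] at this
    simp only [MulEquiv.toEquiv_eq_coe, EquivLike.coe_coe, MulAut.conj_apply, inv_inv, this]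
    simp [mul_assoc]
  have hcomm : ∀ b : ℂ[G], a * b = b * a := by
    intro b
    induction b using MonoidAlgebra.induction_linear with
    | zero => simp
    | add x y hx hy => rw [mul_add, add_mul, hx, hy]
    | single h c =>
      have hc : MonoidAlgebra.single h c = c • (MonoidAlgebra.single h 1 : ℂ[G]) := by simp
      rw [hc, mul_smul_comm, smul_mul_assoc, hsingle]
  let L : ℂ[G] →ₗ[ℂ[G]] ℂ[G] := LinearMap.toSpanSingleton _ _ a
  have hL : LinearMap.ker L = ⊤ := by
    rw [← top_le_iff, ← IsSemisimpleModule.sSup_simples_eq_top ℂ[G] ℂ[G]]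
    refine sSup_le fun S hS => ?_
    have hS : IsSimpleModule ℂ[G] S := hS
    have hfin : FiniteDimensional ℂ S :=
      inferInstanceAs (FiniteDimensional ℂ (S.restrictScalars ℂ))
    let ρ : Representation ℂ G S := Representation.ofModule' S
    have hρ : ρ.asAlgebraHom = Algebra.lsmul ℂ ℂ S :=
      (MonoidAlgebra.lift ℂ (S →ₗ[ℂ] S) G).apply_symm_apply _
    let e : ρ.asModule ≃ₗ[ℂ[G]] S :=
      { ρ.asModuleEquiv with
        map_smul' := fun r x => by
          simp [hρ] }
    have hirr : ρ.IsIrreducible :=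
      ρ.irreducible_iff_isSimpleModule_asModule.mpr (IsSimpleModule.congr e)
    have h0 := horth _ (isIrrChar_character ρ)
    let l : Module.End ℂ[G] S :=
      { toFun := fun x => a • x
        map_add' := fun x y => smul_add a x y
        map_smul' := fun b x => by simp only [← mul_smul, hcomm, RingHom.id_apply] }
    obtain ⟨c, hc⟩ := (IsSimpleModule.algebraMap_end_bijective_of_isAlgClosed ℂ
      (A := ℂ[G]) (V := S)).2 l
    have hc0 : c = 0 := by
      have hsum : ∑ g, φ g • ρ g = c • (LinearMap.id : S →ₗ[ℂ] S) := by
        calc ∑ g, φ g • ρ g = ρ.asAlgebraHom a := by simp [a]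
          _ = c • (LinearMap.id : S →ₗ[ℂ] S) := by
            rw [hρ]
            ext1 x
            simpa [l] using (LinearMap.congr_fun hc x).symm
      have htr := congrArg (LinearMap.trace ℂ S) hsum
      simp only [map_sum, map_smul, LinearMap.trace_id, smul_eq_mul] at htr
      have hnt : Nontrivial S := IsSimpleModule.nontrivial ℂ[G] S
      have hpos : (Module.finrank ℂ S : ℂ) ≠ 0 := by
        exact_mod_cast Module.finrank_pos.ne'
      exact (mul_eq_zero.mp (htr.symm.trans h0)).resolve_right hpos
    intro x hx
    have := congrArg (fun m : Module.End ℂ[G] S => ((m ⟨x, hx⟩ : S) : ℂ[G])) hc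
    simp [l, hc0] at this
    simp [L, ← hcomm, ← this]
  have ha : a = 0 := by
    have : (1 : ℂ[G]) ∈ LinearMap.ker L := hL ▸ Submodule.mem_top
    simpa [L] using this
  ext g
  have h := congrArg (fun b : ℂ[G] => b.coeff g) ha
  simpa [a, MonoidAlgebra.coeff_single, Finsupp.single_apply] using h

/-- Irreducible characters are class functions. -/
theorem IsIrrChar.apply_eq_of_isConj {G : Type} [Group G] {f : G → ℂ} (hf : IsIrrChar G f)
    {g h : G} (hgh : IsConj g h) : f g = f h := by
  obtain ⟨V, -, rfl⟩ := hf
  obtain ⟨c, rfl⟩ := isConj_iff.mp hgh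
  exact (V.char_conj g c).symm

theorem IsIrrChar.sum_mul_inv_self {G : Type} [Group G] [Fintype G] {f : G → ℂ}
    (hf : IsIrrChar G f) : ∑ g, f g * f g⁻¹ = Nat.card G := by
  obtain ⟨V, hV, rfl⟩ := hf
  exact V.simple_iff_char_is_norm_one.mp hV

theorem IsIrrChar.sum_mul_inv_of_ne {G : Type} [Group G] [Fintype G] {f f' : G → ℂ}
    (hf : IsIrrChar G f) (hf' : IsIrrChar G f') (hne : f ≠ f') :
    ∑ g, f g * f' g⁻¹ = 0 := by
  classical
  obtain ⟨V, hV, rfl⟩ := hf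
  obtain ⟨W, hW, rfl⟩ := hf'
  have := invertibleOfNonzero (NeZero.ne (Nat.card G : ℂ))
  have h := FDRep.char_orthonormal V W
  rw [if_neg fun ⟨i⟩ => hne (FDRep.char_iso i)] at h
  exact (mul_eq_zero.mp h).resolve_left (inv_ne_zero (NeZero.ne _))

/-- A representation whose character has norm one has an irreducible character. -/
theorem isIrrChar_of_norm_one {G V : Type} [Group G] [Fintype G] [AddCommGroup V] [Module ℂ V]
    [FiniteDimensional ℂ V] (ρ : Representation ℂ G V)
    (h : ∑ g, ρ.character g * ρ.character g⁻¹ = Nat.card G) : IsIrrChar G ρ.character :=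
  ⟨FDRep.of ρ, (FDRep.of ρ).simple_iff_char_is_norm_one.mpr h, rfl⟩

theorem isIrrChar_one {G : Type} [Group G] [Finite G] : IsIrrChar G 1 := by
  cases nonempty_fintype G
  have h : (Representation.trivial ℂ G ℂ).character = 1 := by
    ext g
    simp [Representation.character]
  rw [← h]
  apply isIrrChar_of_norm_one
  simp [h]

/-- Pulling back along an automorphism preserves irreducible characters. -/
theorem IsIrrChar.comp_mulEquiv {G : Type} [Group G] [Finite G] {f : G → ℂ}
    (hf : IsIrrChar G f) (e : G ≃* G) : IsIrrChar G (f ∘ e) := by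
  cases nonempty_fintype G
  have hn := hf.sum_mul_inv_self
  obtain ⟨V, hV, rfl⟩ := hf
  let ρ : Representation ℂ G V := MonoidHom.comp V.ρ e.toMonoidHom
  have hρ : ρ.character = V.character ∘ e := rfl
  rw [← hρ]
  apply isIrrChar_of_norm_one
  rw [← hn, hρ, ← Equiv.sum_comp e.toEquiv fun g => V.character g * V.character g⁻¹]
  simp

/-- The number of elements in a conjugacy class. -/
noncomputable def ConjClasses.size {G : Type} [Group G] (c : ConjClasses G) : ℕ :=
  Nat.card {g : G // ConjClasses.mk g = c}

theorem ConjClasses.size_pos {G : Type} [Group G] [Finite G] (c : ConjClasses G) :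
    0 < c.size := by
  obtain ⟨g, rfl⟩ := ConjClasses.exists_rep c
  have : Nonempty {h : G // ConjClasses.mk h = ConjClasses.mk g} := ⟨⟨g, rfl⟩⟩
  exact Nat.card_pos

theorem ConjClasses.sum_comp_mk {G : Type} [Group G] [Fintype G] [Fintype (ConjClasses G)]
    (F : ConjClasses G → ℂ) : ∑ g : G, F (ConjClasses.mk g) = ∑ c, (c.size : ℂ) * F c := by
  classical
  rw [← Finset.sum_fiberwise Finset.univ ConjClasses.mk]
  refine Finset.sum_congr rfl fun c _ => ?_
  rw [Finset.sum_congr rfl fun g hg => by rw [(Finset.mem_filter.mp hg).2], Finset.sum_const,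
    nsmul_eq_mul, ConjClasses.size, Nat.card_eq_fintype_card, Fintype.card_subtype]

namespace IsTableAut

variable {G : Type} [Group G] {σ : Equiv.Perm {f : G → ℂ // IsIrrChar G f}}
  {τ : Equiv.Perm (ConjClasses G)}

/-- The class permutation of a table automorphism preserves the sizes of classes. -/
theorem size_apply [Finite G] (hστ : IsTableAut G σ τ) (c : ConjClasses G) :
    (τ c).size = c.size := by
  classical
  cases nonempty_fintype G
  have := Fintype.ofFinite (ConjClasses G)
  let φ : G → ℂ := fun g => (τ (ConjClasses.mk g)).size / (ConjClasses.mk g).size - 1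
  have hφ : φ = 0 := by
    refine eq_zero_of_orthogonal_irrChar φ (fun g h => ?_) fun f hf => ?_
    · have : ConjClasses.mk (h * g * h⁻¹) = ConjClasses.mk g :=
        ConjClasses.mk_eq_mk_iff_isConj.mpr (isConj_iff.mpr ⟨h, rfl⟩).symm
      simp only [φ, this]
    · let f₀ : {f : G → ℂ // IsIrrChar G f} := ⟨f, hf⟩
      let F : {f : G → ℂ // IsIrrChar G f} → ConjClasses G → ℂ := fun f c => f.1 c.out
      have hmk : ∀ c : ConjClasses G, ConjClasses.mk c.out = c := fun c => Quotient.out_eq c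
      have hF : ∀ (f : {f : G → ℂ // IsIrrChar G f}) (g), f.1 g = F f (ConjClasses.mk g) :=
        fun f g => f.2.apply_eq_of_isConj (ConjClasses.mk_eq_mk_iff_isConj.mp (hmk _).symm)
      have hFτ : ∀ c, F (σ f₀) (τ c) = F f₀ c := fun c =>
        hστ f₀ c.out (τ c).out (by rw [hmk, hmk])
      have h1 : ∑ g, φ g * f g = ∑ g, (σ f₀).1 g - ∑ g, f₀.1 g := by
        have hl : ∑ g, φ g * f g =
            ∑ c : ConjClasses G, (c.size : ℂ) * (((τ c).size / c.size - 1 : ℂ) * F f₀ c) := by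
          rw [← ConjClasses.sum_comp_mk fun c => ((τ c).size / c.size - 1 : ℂ) * F f₀ c]
          exact Finset.sum_congr rfl fun g _ => by rw [show f g = _ from hF f₀ g]
        have hr : ∀ f : {f : G → ℂ // IsIrrChar G f},
            ∑ g, f.1 g = ∑ c : ConjClasses G, (c.size : ℂ) * F f c := fun f => by
          rw [← ConjClasses.sum_comp_mk]
          exact Finset.sum_congr rfl fun g _ => hF f g
        rw [hl, hr, hr, ← Equiv.sum_comp τ (fun c => (c.size : ℂ) * F (σ f₀) c),
          ← Finset.sum_sub_distrib]
        refine Finset.sum_congr rfl fun c _ => ?_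
        have hpos : (c.size : ℂ) ≠ 0 := by exact_mod_cast c.size_pos.ne'
        rw [hFτ]
        field_simp
      rw [h1]
      let e : {f : G → ℂ // IsIrrChar G f} := ⟨1, isIrrChar_one⟩
      have he : σ e = e := by
        ext g
        obtain ⟨g', hg'⟩ := ConjClasses.exists_rep (τ.symm (ConjClasses.mk g))
        exact hστ e g' g (by rw [show ConjClasses.mk g' = _ from hg', τ.apply_symm_apply])
      by_cases h : f₀ = e
      · rw [h, he, sub_self]
      · have hz : ∀ f' : {f : G → ℂ // IsIrrChar G f}, f' ≠ e → ∑ g, f'.1 g = 0 := by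
          intro f' hf'
          simpa [e] using f'.2.sum_mul_inv_of_ne isIrrChar_one
            (fun h => hf' (Subtype.ext h))
        rw [hz _ h, hz, sub_zero]
        exact fun h' => h (σ.injective (h'.trans he.symm))
  obtain ⟨g, rfl⟩ := ConjClasses.exists_rep c
  have hg := congrFun hφ g
  have hpos : ((ConjClasses.mk g).size : ℂ) ≠ 0 := by
    exact_mod_cast (ConjClasses.size_pos _).ne'
  simp only [φ, Pi.zero_apply, sub_eq_zero, div_eq_one_iff_eq hpos] at hg
  exact_mod_cast hg

/-- The characters of a table automorphism are determined by its class permutation. -/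
theorem character_perm_unique {σ' : Equiv.Perm {f : G → ℂ // IsIrrChar G f}}
    (h : IsTableAut G σ τ) (h' : IsTableAut G σ' τ) : σ = σ' := by
  ext f g
  obtain ⟨g', hg'⟩ := ConjClasses.exists_rep (τ.symm (ConjClasses.mk g))
  have hg : ConjClasses.mk g = τ (ConjClasses.mk g') := by
    rw [show ConjClasses.mk g' = _ from hg', τ.apply_symm_apply]
  rw [h f g' g hg, h' f g' g hg]

end IsTableAut

/-- The table automorphism induced by an automorphism of the group. -/
theorem exists_isTableAut_of_mulEquiv {G : Type} [Group G] [Finite G] (e : G ≃* G) :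
    ∃ (σ : Equiv.Perm {f : G → ℂ // IsIrrChar G f}) (τ : Equiv.Perm (ConjClasses G)),
      IsTableAut G σ τ ∧ ∀ g, τ (ConjClasses.mk g) = ConjClasses.mk (e g) := by
  refine ⟨⟨fun f => ⟨f.1 ∘ e.symm, f.2.comp_mulEquiv e.symm⟩,
      fun f => ⟨f.1 ∘ e, f.2.comp_mulEquiv e⟩, fun f => ?_, fun f => ?_⟩,
    ⟨ConjClasses.map e.toMonoidHom, ConjClasses.map e.symm.toMonoidHom, fun c => ?_, fun c => ?_⟩,
    fun f g h hgh => ?_, fun g => rfl⟩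
  · ext g
    simp
  · ext g
    simp
  · obtain ⟨g, rfl⟩ := ConjClasses.exists_rep c
    exact congrArg ConjClasses.mk (e.symm_apply_apply g)
  · obtain ⟨g, rfl⟩ := ConjClasses.exists_rep c
    exact congrArg ConjClasses.mk (e.apply_symm_apply g)
  · have : IsConj h (e g) := ConjClasses.mk_eq_mk_iff_isConj.mp hgh
    have h1 := (f.2.comp_mulEquiv e.symm).apply_eq_of_isConj this
    simpa using h1

namespace PermSix

open Equiv Equiv.Perm

/-- The six synthematic totals, each given by its five fixed-point-free involutions. They are
labelled so that the induced automorphism `outer` of `S₆` is an involution. -/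
def total : Fin 6 → Finset (Perm (Fin 6)) :=
  ![{swap 0 3 * swap 1 5 * swap 2 4, swap 0 1 * swap 2 3 * swap 4 5,
      swap 0 2 * swap 1 4 * swap 3 5, swap 0 4 * swap 1 3 * swap 2 5,
      swap 0 5 * swap 1 2 * swap 3 4},
    {swap 0 2 * swap 1 5 * swap 3 4, swap 0 3 * swap 1 4 * swap 2 5,
      swap 0 5 * swap 1 3 * swap 2 4, swap 0 1 * swap 2 3 * swap 4 5,
      swap 0 4 * swap 1 2 * swap 3 5},
    {swap 0 5 * swap 1 4 * swap 2 3, swap 0 3 * swap 1 5 * swap 2 4,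
      swap 0 1 * swap 2 5 * swap 3 4, swap 0 2 * swap 1 3 * swap 4 5,
      swap 0 4 * swap 1 2 * swap 3 5},
    {swap 0 1 * swap 2 5 * swap 3 4, swap 0 5 * swap 1 3 * swap 2 4,
      swap 0 2 * swap 1 4 * swap 3 5, swap 0 3 * swap 1 2 * swap 4 5,
      swap 0 4 * swap 1 5 * swap 2 3},
    {swap 0 1 * swap 2 4 * swap 3 5, swap 0 3 * swap 1 4 * swap 2 5,
      swap 0 2 * swap 1 3 * swap 4 5, swap 0 5 * swap 1 2 * swap 3 4,
      swap 0 4 * swap 1 5 * swap 2 3},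
    {swap 0 1 * swap 2 4 * swap 3 5, swap 0 5 * swap 1 4 * swap 2 3,
      swap 0 2 * swap 1 5 * swap 3 4, swap 0 4 * swap 1 3 * swap 2 5,
      swap 0 3 * swap 1 2 * swap 4 5}]

/-- The images of the adjacent transpositions under `outer`. -/
def outerSwap : Fin 5 → Perm (Fin 6) :=
  ![swap 0 1 * swap 2 3 * swap 4 5, swap 0 4 * swap 1 2 * swap 3 5,
    swap 0 1 * swap 2 5 * swap 3 4, swap 0 4 * swap 1 5 * swap 2 3,
    swap 0 1 * swap 2 4 * swap 3 5]

/-- Conjugation by `g` permutes the six totals according to `π`. -/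
def PermutesTotals (g π : Perm (Fin 6)) : Prop :=
  ∀ i, (total i).image (MulAut.conj g) = total (π i)

instance (g π : Perm (Fin 6)) : Decidable (PermutesTotals g π) :=
  inferInstanceAs (Decidable (∀ _, _))

theorem total_injective : Function.Injective total := by
  have h : ∀ i j, total i = total j → i = j := by decide +kernel
  exact fun i j => h i j

namespace PermutesTotals

theorem one : PermutesTotals 1 1 := fun i => by simp

theorem mul {g h π ρ : Perm (Fin 6)} (hg : PermutesTotals g π) (hh : PermutesTotals h ρ) :
    PermutesTotals (g * h) (π * ρ) := fun i => by
  rw [Perm.mul_apply, ← hg, ← hh, Finset.image_image, map_mul]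
  rfl

theorem unique {g π ρ : Perm (Fin 6)} (hπ : PermutesTotals g π) (hρ : PermutesTotals g ρ) :
    π = ρ :=
  Equiv.ext fun i => total_injective ((hπ i).symm.trans (hρ i))

theorem swap_outerSwap (k : Fin 5) :
    PermutesTotals (swap k.castSucc k.succ) (outerSwap k) := by
  revert k
  decide +kernel

theorem outerSwap_swap (k : Fin 5) :
    PermutesTotals (outerSwap k) (swap k.castSucc k.succ) := by
  revert k
  decide +kernel

theorem exists_perm (g : Perm (Fin 6)) : ∃ π, PermutesTotals g π := by
  have hg : g ∈ Submonoid.closure (Set.range fun k : Fin 5 => swap k.castSucc k.succ) := by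
    rw [mclosure_swap_castSucc_succ]
    trivial
  induction hg using Submonoid.closure_induction with
  | mem x hx =>
    obtain ⟨k, rfl⟩ := hx
    exact ⟨_, swap_outerSwap k⟩
  | one => exact ⟨1, one⟩
  | mul x y _ _ hx hy =>
    obtain ⟨π, hπ⟩ := hx
    obtain ⟨ρ, hρ⟩ := hy
    exact ⟨π * ρ, hπ.mul hρ⟩

end PermutesTotals

/-- The action of `S₆` on the six totals. -/
noncomputable def outerHom : Perm (Fin 6) →* Perm (Fin 6) where
  toFun g := (PermutesTotals.exists_perm g).choose
  map_one' := (PermutesTotals.exists_perm 1).choose_spec.unique .one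
  map_mul' g h := (PermutesTotals.exists_perm (g * h)).choose_spec.unique
    ((PermutesTotals.exists_perm g).choose_spec.mul (PermutesTotals.exists_perm h).choose_spec)

theorem outerHom_eq {g π : Perm (Fin 6)} (h : PermutesTotals g π) : outerHom g = π :=
  (PermutesTotals.exists_perm g).choose_spec.unique h

theorem outerHom_comp_self : outerHom.comp outerHom = MonoidHom.id _ := by
  refine MonoidHom.eq_of_eqOn_denseM (mclosure_swap_castSucc_succ 5) ?_
  rintro _ ⟨k, rfl⟩
  simp [outerHom_eq (PermutesTotals.swap_outerSwap k),
    outerHom_eq (PermutesTotals.outerSwap_swap k)]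

/-- An outer automorphism of `S₆`. -/
noncomputable def outer : Perm (Fin 6) ≃* Perm (Fin 6) :=
  outerHom.toMulEquiv outerHom outerHom_comp_self outerHom_comp_self

theorem outer_swap : outer (swap 0 1) = outerSwap 0 :=
  outerHom_eq (PermutesTotals.swap_outerSwap 0)

theorem not_isConj_outer_swap : ¬ IsConj (outer (swap 0 1)) (swap 0 1) := by
  rw [outer_swap, isConj_iff_cycleType_eq]
  intro h
  have h' := congrArg Multiset.sum h
  rw [sum_cycleType, sum_cycleType] at h'
  revert h'
  decide +kernel

/-- The cycle types of the conjugacy classes of `S₆`. -/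
def cycleTypes : Fin 11 → Multiset ℕ :=
  ![0, {2}, {2, 2}, {2, 2, 2}, {3}, {3, 3}, {4}, {4, 2}, {5}, {6}, {3, 2}]

/-- The sizes of the conjugacy classes of `S₆`. -/
def sizes : Fin 11 → ℕ := ![1, 15, 45, 15, 40, 40, 90, 90, 144, 120, 120]

/-- The values of the sign character. -/
def signValues : Fin 11 → ℤ := ![1, -1, 1, -1, 1, 1, -1, 1, 1, -1, -1]

/-- The values of the standard character. -/
def standardValues : Fin 11 → ℤ := ![5, 3, 1, -1, 2, -1, 1, -1, 0, -1, 0]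

/-- The permutation of the conjugacy classes induced by an outer automorphism. -/
def outerClass : Fin 11 → Fin 11 := ![0, 3, 2, 1, 5, 4, 6, 7, 8, 10, 9]

theorem cycleTypes_injective : Function.Injective cycleTypes := by
  have h : ∀ i j, cycleTypes i = cycleTypes j → i = j := by decide +kernel
  exact fun i j => h i j

theorem exists_perm_cycleType (i : Fin 11) : ∃ g : Perm (Fin 6), g.cycleType = cycleTypes i := by
  rw [exists_with_cycleType_iff]
  revert i
  decide +kernel

theorem card_cycleType_eq (i : Fin 11) :
    (Finset.univ.filter fun g : Perm (Fin 6) => g.cycleType = cycleTypes i).card = sizes i := by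
  have key : ∀ i, (cycleTypes i).sum ≤ Fintype.card (Fin 6) ∧ (∀ a ∈ cycleTypes i, 2 ≤ a) ∧
      sizes i * ((Fintype.card (Fin 6) - (cycleTypes i).sum).factorial * (cycleTypes i).prod *
        ∏ n ∈ (cycleTypes i).toFinset, ((cycleTypes i).count n).factorial) =
      (Fintype.card (Fin 6)).factorial := by
    decide +kernel
  obtain ⟨hsum, hmem, hsize⟩ := key i
  have h := card_of_cycleType_mul_eq (Fin 6) (cycleTypes i)
  rw [if_pos ⟨hsum, hmem⟩, ← hsize] at h
  refine Nat.eq_of_mul_eq_mul_right (Nat.pos_of_ne_zero fun h0 => ?_) h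
  rw [h0, mul_zero] at hsize
  exact Nat.factorial_ne_zero _ hsize.symm

theorem exists_cycleType_eq (g : Perm (Fin 6)) : ∃ i, g.cycleType = cycleTypes i := by
  have h : (Finset.univ.biUnion fun i => Finset.univ.filter fun g : Perm (Fin 6) =>
      g.cycleType = cycleTypes i) = Finset.univ := by
    rw [← Finset.card_eq_iff_eq_univ, Finset.card_biUnion, Fintype.card_perm]
    · simp only [card_cycleType_eq]
      decide +kernel
    · refine fun i _ j _ hij => Finset.disjoint_filter.mpr fun g _ hi hj => hij ?_
      exact cycleTypes_injective (hi.symm.trans hj)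
  simpa using h.ge (Finset.mem_univ g)

/-- The index of the conjugacy class of a permutation. -/
noncomputable def index (g : Perm (Fin 6)) : Fin 11 := (exists_cycleType_eq g).choose

theorem cycleType_eq (g : Perm (Fin 6)) : g.cycleType = cycleTypes (index g) :=
  (exists_cycleType_eq g).choose_spec

theorem index_eq_iff {g : Perm (Fin 6)} {i : Fin 11} :
    index g = i ↔ g.cycleType = cycleTypes i := by
  rw [cycleType_eq, cycleTypes_injective.eq_iff]

theorem index_eq_index_iff {g h : Perm (Fin 6)} : index g = index h ↔ IsConj g h := by
  rw [index_eq_iff, ← cycleType_eq, isConj_iff_cycleType_eq]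

theorem index_inv (g : Perm (Fin 6)) : index g⁻¹ = index g := by
  rw [index_eq_iff, cycleType_inv, cycleType_eq]

theorem card_index_eq (i : Fin 11) :
    (Finset.univ.filter fun g : Perm (Fin 6) => index g = i).card = sizes i := by
  simp only [index_eq_iff, card_cycleType_eq]

theorem index_surjective : Function.Surjective index := fun i =>
  (exists_perm_cycleType i).imp fun _ h => index_eq_iff.mpr h

theorem sum_comp_index (y : Fin 11 → ℂ) :
    ∑ g : Perm (Fin 6), y (index g) = ∑ i, (sizes i : ℂ) * y i := by
  rw [← Finset.sum_fiberwise Finset.univ index]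
  refine Finset.sum_congr rfl fun i _ => ?_
  rw [Finset.sum_congr rfl fun g hg => by rw [(Finset.mem_filter.mp hg).2], Finset.sum_const,
    nsmul_eq_mul, card_index_eq]

/-- The conjugacy classes of `S₆` are indexed by their cycle types. -/
noncomputable def classEquiv : ConjClasses (Perm (Fin 6)) ≃ Fin 11 :=
  Equiv.ofBijective
    (Quotient.lift index fun _ _ h => index_eq_index_iff.mpr h)
    ⟨fun c d => by
      obtain ⟨g, rfl⟩ := ConjClasses.exists_rep c
      obtain ⟨h, rfl⟩ := ConjClasses.exists_rep d
      exact fun hgh => ConjClasses.mk_eq_mk_iff_isConj.mpr (index_eq_index_iff.mp hgh),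
    fun i => (index_surjective i).elim fun g hg => ⟨ConjClasses.mk g, hg⟩⟩

theorem classEquiv_mk (g : Perm (Fin 6)) : classEquiv (ConjClasses.mk g) = index g := rfl

theorem size_eq (c : ConjClasses (Perm (Fin 6))) : c.size = sizes (classEquiv c) := by
  rw [ConjClasses.size, Nat.card_eq_fintype_card, Fintype.card_subtype, ← card_index_eq]
  congr 1
  ext g
  simp [← classEquiv_mk]

theorem isIrrChar_of_values {V : Type} [AddCommGroup V] [Module ℂ V] [FiniteDimensional ℂ V]
    (ρ : Representation ℂ (Perm (Fin 6)) V) (x : Fin 11 → ℤ)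
    (hρ : ∀ g, ρ.character g = x (index g)) (hx : ∑ i, (sizes i : ℤ) * (x i * x i) = 720) :
    IsIrrChar (Perm (Fin 6)) fun g => x (index g) := by
  have h : ρ.character = fun g => (x (index g) : ℂ) := funext hρ
  rw [← h]
  apply isIrrChar_of_norm_one
  simp only [h, index_inv]
  rw [sum_comp_index fun i => (x i : ℂ) * x i]
  have : (720 : ℂ) = ((720 : ℤ) : ℂ) := by norm_num
  rw [Nat.card_eq_fintype_card, Fintype.card_perm, Fintype.card_fin,
    show Nat.factorial 6 = 720 from rfl, Nat.cast_ofNat, this, ← hx]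
  push_cast
  rfl

theorem sign_eq (g : Perm (Fin 6)) : (sign g : ℤ) = signValues (index g) := by
  rw [sign_of_cycleType, cycleType_eq]
  generalize index g = i
  revert i
  decide +kernel

theorem isIrrChar_sign : IsIrrChar (Perm (Fin 6)) fun g => signValues (index g) := by
  refine isIrrChar_of_values
    ((Algebra.lsmul ℂ ℂ ℂ).toMonoidHom.comp
      ((algebraMap ℤ ℂ).toMonoidHom.comp ((Units.coeHom ℤ).comp sign)))
    _ (fun g => ?_) (by decide +kernel)
  rw [← sign_eq]
  simp only [Representation.character, MonoidHom.comp_apply]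
  rw [show ∀ z : ℂ, (Algebra.lsmul ℂ ℂ ℂ).toMonoidHom z = z • (1 : ℂ →ₗ[ℂ] ℂ) from
    fun z => by ext; simp, map_smul, LinearMap.trace_one]
  simp

theorem card_fixedBy_eq (g : Perm (Fin 6)) :
    ((Finset.univ.filter fun i => g i = i).card : ℤ) - 1 = standardValues (index g) := by
  have h : (Finset.univ.filter fun i => g i = i).card + g.cycleType.sum = 6 := by
    rw [sum_cycleType, support, Finset.card_filter_add_card_filter_not]
    rfl
  have key : ∀ i, standardValues i = 5 - (cycleTypes i).sum := by decide +kernel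
  rw [key, ← cycleType_eq]
  lia

/-- The vectors whose coordinates sum to zero. -/
def standardModule : Submodule ℂ (Fin 6 → ℂ) :=
  LinearMap.ker (∑ i, LinearMap.proj i : (Fin 6 → ℂ) →ₗ[ℂ] ℂ)

theorem mem_standardModule {v : Fin 6 → ℂ} : v ∈ standardModule ↔ ∑ i, v i = 0 := by
  simp [standardModule]

/-- The permutation representation. -/
def permRep : Representation ℂ (Perm (Fin 6)) (Fin 6 → ℂ) where
  toFun g := LinearMap.funLeft ℂ ℂ (g⁻¹ : Perm (Fin 6))
  map_one' := rfl
  map_mul' g h := by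
    ext
    simp [LinearMap.funLeft]

theorem permRep_apply (g : Perm (Fin 6)) (v : Fin 6 → ℂ) (i : Fin 6) :
    permRep g v i = v (g⁻¹ i) := rfl

theorem permRep_mem (g : Perm (Fin 6)) : ∀ v ∈ standardModule, permRep g v ∈ standardModule := by
  intro v hv
  rw [mem_standardModule] at hv ⊢
  simp only [permRep_apply]
  rw [Equiv.sum_comp (g⁻¹) v, hv]

/-- The standard representation of `S₆`. -/
def standardRep : Representation ℂ (Perm (Fin 6)) standardModule where
  toFun g := (permRep g).restrict (permRep_mem g)
  map_one' := by
    ext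
    simp
  map_mul' g h := by
    ext
    simp

theorem standardRep_character (g : Perm (Fin 6)) :
    standardRep.character g = standardValues (index g) := by
  let p : (Fin 6 → ℂ) →ₗ[ℂ] (Fin 6 → ℂ) :=
    LinearMap.id - LinearMap.pi fun _ => (6 : ℂ)⁻¹ • ∑ i, LinearMap.proj i
  have hp : ∀ v i, p v i = v i - 6⁻¹ * ∑ j, v j := by
    intro v i
    simp [p]
  have hmem : ∀ v, (permRep g ∘ₗ p) v ∈ standardModule := by
    intro v
    apply permRep_mem
    rw [mem_standardModule]
    simp [hp]
  have hres : (permRep g ∘ₗ p).restrict (fun v _ => hmem v) = standardRep g := by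
    ext v i
    have hv := mem_standardModule.mp v.2
    simp [standardRep, permRep_apply, hp, hv]
  rw [Representation.character, ← hres, LinearMap.trace_restrict_eq_of_forall_mem _ _ hmem,
    LinearMap.trace_eq_matrix_trace ℂ (Pi.basisFun ℂ (Fin 6)), Matrix.trace, ← card_fixedBy_eq]
  have hcard : (Finset.univ.filter fun i => g.symm i = i).card =
      (Finset.univ.filter fun i => g i = i).card := by
    congr 1
    ext i
    simp only [Finset.mem_filter, Finset.mem_univ, true_and, Equiv.symm_apply_eq]
    exact eq_comm
  simp [permRep_apply, hp, Pi.single_apply, hcard]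

theorem isIrrChar_standard : IsIrrChar (Perm (Fin 6)) fun g => standardValues (index g) :=
  isIrrChar_of_values standardRep _ standardRep_character (by decide +kernel)

theorem sizes_permCongr_apply
    {σ : Equiv.Perm {f : Perm (Fin 6) → ℂ // IsIrrChar (Perm (Fin 6)) f}}
    {τ : Equiv.Perm (ConjClasses (Perm (Fin 6)))} (h : IsTableAut (Perm (Fin 6)) σ τ)
    (i : Fin 11) : sizes (classEquiv.permCongr τ i) = sizes i := by
  have hi := h.size_apply (classEquiv.symm i)
  rwa [size_eq, size_eq, Equiv.apply_symm_apply] at hi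

/-- The pairing of an irreducible character of `S₆` with its image under a table automorphism. -/
theorem sum_mul_eq_of_isTableAut
    {σ : Equiv.Perm {f : Perm (Fin 6) → ℂ // IsIrrChar (Perm (Fin 6)) f}}
    {τ : Equiv.Perm (ConjClasses (Perm (Fin 6)))} (h : IsTableAut (Perm (Fin 6)) σ τ)
    {x : Fin 11 → ℤ} (hx : IsIrrChar (Perm (Fin 6)) fun g => x (index g)) :
    ∑ i, (sizes i : ℤ) * (x i * x (classEquiv.permCongr τ i)) = 0 ∨
      ∑ i, (sizes i : ℤ) * (x i * x (classEquiv.permCongr τ i)) = 720 := by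
  have hsize := sizes_permCongr_apply h
  set t := classEquiv.permCongr τ with ht
  let f : {f : Perm (Fin 6) → ℂ // IsIrrChar (Perm (Fin 6)) f} := ⟨_, hx⟩
  have hf : ∀ g, f.1 g = x (index g) := fun _ => rfl
  have hσ : ∀ g, (σ f).1 g = x (t.symm (index g)) := fun g => by
    obtain ⟨g', hg'⟩ := index_surjective (t.symm (index g))
    rw [h f g' g, hf, hg']
    rw [Equiv.eq_symm_apply, ht, Equiv.permCongr_apply, ← classEquiv_mk,
      Equiv.symm_apply_apply, ← classEquiv_mk] at hg'
    exact (classEquiv.injective hg').symm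
  have hsum : ∑ g, (σ f).1 g * f.1 g⁻¹ =
      ((∑ i, (sizes i : ℤ) * (x i * x (t i)) : ℤ) : ℂ) := by
    simp only [hσ, hf, index_inv]
    rw [sum_comp_index fun i => (x (t.symm i) : ℂ) * x i, ← Equiv.sum_comp t]
    simp [hsize]
  by_cases hfix : σ f = f
  · right
    rw [hfix, f.2.sum_mul_inv_self, Nat.card_eq_fintype_card, Fintype.card_perm,
      Fintype.card_fin] at hsum
    exact_mod_cast hsum.symm
  · left
    rw [(σ f).2.sum_mul_inv_of_ne f.2 fun h => hfix (Subtype.ext h)] at hsum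
    exact_mod_cast hsum.symm

theorem eq_or_eq_outerClass (t : Fin 11 → Fin 11) (ht : Function.Injective t)
    (hsize : ∀ i, sizes (t i) = sizes i)
    (hsign : ∑ i, (sizes i : ℤ) * (signValues i * signValues (t i)) = 0 ∨
      ∑ i, (sizes i : ℤ) * (signValues i * signValues (t i)) = 720)
    (hstd : ∑ i, (sizes i : ℤ) * (standardValues i * standardValues (t i)) = 0 ∨
      ∑ i, (sizes i : ℤ) * (standardValues i * standardValues (t i)) = 720) :
    t = id ∨ t = outerClass := by
  have h0 := (by decide : ∀ j, sizes j = sizes 0 → j = 0) _ (hsize 0)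
  have h1 := (by decide : ∀ j, sizes j = sizes 1 → j = 1 ∨ j = 3) _ (hsize 1)
  have h2 := (by decide : ∀ j, sizes j = sizes 2 → j = 2) _ (hsize 2)
  have h3 := (by decide : ∀ j, sizes j = sizes 3 → j = 1 ∨ j = 3) _ (hsize 3)
  have h4 := (by decide : ∀ j, sizes j = sizes 4 → j = 4 ∨ j = 5) _ (hsize 4)
  have h5 := (by decide : ∀ j, sizes j = sizes 5 → j = 4 ∨ j = 5) _ (hsize 5)
  have h6 := (by decide : ∀ j, sizes j = sizes 6 → j = 6 ∨ j = 7) _ (hsize 6)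
  have h7 := (by decide : ∀ j, sizes j = sizes 7 → j = 6 ∨ j = 7) _ (hsize 7)
  have h8 := (by decide : ∀ j, sizes j = sizes 8 → j = 8) _ (hsize 8)
  have h9 := (by decide : ∀ j, sizes j = sizes 9 → j = 9 ∨ j = 10) _ (hsize 9)
  have h10 := (by decide : ∀ j, sizes j = sizes 10 → j = 9 ∨ j = 10) _ (hsize 10)
  have hne : ∀ i j, i ≠ j → t i ≠ t j := fun i j hij h => hij (ht h)
  have h13 := hne 1 3 (by decide)
  have h45 := hne 4 5 (by decide)
  have h67 := hne 6 7 (by decide)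
  have h910 := hne 9 10 (by decide)
  have ht' : t = ![t 0, t 1, t 2, t 3, t 4, t 5, t 6, t 7, t 8, t 9, t 10] := by
    ext i
    fin_cases i <;> rfl
  generalize t 0 = a0 at *
  generalize t 1 = a1 at *
  generalize t 2 = a2 at *
  generalize t 3 = a3 at *
  generalize t 4 = a4 at *
  generalize t 5 = a5 at *
  generalize t 6 = a6 at *
  generalize t 7 = a7 at *
  generalize t 8 = a8 at *
  generalize t 9 = a9 at *
  generalize t 10 = a10 at *
  subst ht' h0 h2 h8
  clear hne hsize ht
  rcases h1 with rfl | rfl <;> rcases h3 with rfl | rfl <;> (try exact absurd rfl h13) <;>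
  rcases h4 with rfl | rfl <;> rcases h5 with rfl | rfl <;> (try exact absurd rfl h45) <;>
  rcases h6 with rfl | rfl <;> rcases h7 with rfl | rfl <;> (try exact absurd rfl h67) <;>
  rcases h9 with rfl | rfl <;> rcases h10 with rfl | rfl <;> (try exact absurd rfl h910) <;>
  revert hsign hstd <;> decide +kernel

theorem eq_one_or_eq_outerClass
    {σ : Equiv.Perm {f : Perm (Fin 6) → ℂ // IsIrrChar (Perm (Fin 6)) f}}
    {τ : Equiv.Perm (ConjClasses (Perm (Fin 6)))} (h : IsTableAut (Perm (Fin 6)) σ τ) :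
    τ = 1 ∨ ⇑(classEquiv.permCongr τ) = outerClass := by
  refine (eq_or_eq_outerClass _ (classEquiv.permCongr τ).injective (fun i => ?_)
    (sum_mul_eq_of_isTableAut h isIrrChar_sign)
    (sum_mul_eq_of_isTableAut h isIrrChar_standard)).imp_left fun hid => ?_
  · exact sizes_permCongr_apply h i
  · ext c
    simpa [Equiv.permCongr_apply] using congrFun hid (classEquiv c)

end PermSix

theorem table_auts_S6_card_two :
    Set.ncard {p : Equiv.Perm {f : Equiv.Perm (Fin 6) → ℂ // IsIrrChar (Equiv.Perm (Fin 6)) f} ×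
        Equiv.Perm (ConjClasses (Equiv.Perm (Fin 6))) |
        IsTableAut (Equiv.Perm (Fin 6)) p.1 p.2} = 2 := by
  obtain ⟨σ₀, τ₀, h₀, hτ₀⟩ := exists_isTableAut_of_mulEquiv PermSix.outer
  have hne : τ₀ ≠ 1 := fun h => PermSix.not_isConj_outer_swap
    (ConjClasses.mk_eq_mk_iff_isConj.mp (by rw [← hτ₀, h, Equiv.Perm.one_apply]))
  have h₁ : IsTableAut (Equiv.Perm (Fin 6)) 1 1 := fun f g h hgh =>
    f.2.apply_eq_of_isConj (ConjClasses.mk_eq_mk_iff_isConj.mp hgh)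
  rw [Set.ncard_eq_two]
  refine ⟨(1, 1), (σ₀, τ₀), fun h => hne (congrArg Prod.snd h).symm, ?_⟩
  ext ⟨σ, τ⟩
  simp only [Set.mem_ofPred_eq, Set.mem_insert_iff, Set.mem_singleton_iff, Prod.mk.injEq]
  constructor
  · intro h
    rcases PermSix.eq_one_or_eq_outerClass h with hτ | hτ
    · subst hτ
      exact .inl ⟨h.character_perm_unique h₁, rfl⟩
    · have hτ' := (PermSix.eq_one_or_eq_outerClass h₀).resolve_left hne
      obtain rfl : τ = τ₀ := PermSix.classEquiv.permCongr.injective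
        (Equiv.coe_fn_injective (hτ.trans hτ'.symm))
      exact .inr ⟨h.character_perm_unique h₀, rfl⟩
  · rintro (⟨rfl, rfl⟩ | ⟨rfl, rfl⟩)
    exacts [h₁, h₀]
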